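/- arXiv:1705.01162 — 3 statements merged into one kernel-verified Lean document; each statement's English description precedes it below -/
import Mathlib

section
/- Let H₁ and H₂ be nonzero separable complex Hilbert spaces. Every bimodule endomorphism φ of K(H₁,H₂) is given by multiplication by a scalar: there exists c ∈ ℂ such that φ(a) = c • a for every a ∈ K(H₁,H₂). -/
/-- Rank-one operators are compact. -/
theorem isCompactOperator_rankOne_aux {E F : Type*}
    [NormedAddCommGroup E] [InnerProductSpace ℂ E]
    [NormedAddCommGroup F] [InnerProductSpace ℂ F] (x : E) (y : F) :
    IsCompactOperator (InnerProductSpace.rankOne ℂ x y) := by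
  rw [InnerProductSpace.rankOne_def']
  exact (isCompactOperator_of_locallyCompactSpace_dom
    (innerSL ℂ y)).clm_comp (ContinuousLinearMap.toSpanSingleton ℂ x)

/-- Let `H₁` and `H₂` be nonzero separable complex Hilbert spaces.  Every
bimodule endomorphism `φ` of the space `K(H₁,H₂)` of compact operators `H₁ → H₂` (i.e. every
`ℂ`-linear map `φ : K(H₁,H₂) → K(H₁,H₂)` satisfying `φ (x ∘ a ∘ y) = x ∘ φ a ∘ y` for all
compact operators `x` on `H₂` and `y` on `H₁`) is given by multiplication by a scalar:
there is `c : ℂ` with `φ a = c • a` for all `a`.  Here `compactOperator (RingHom.id ℂ) H₁ H₂`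
is the submodule of `H₁ →L[ℂ] H₂` consisting of compact operators. -/
theorem bimoduleEnd_isScalar
    (H₁ H₂ : Type*)
    [NormedAddCommGroup H₁] [InnerProductSpace ℂ H₁] [CompleteSpace H₁]
    [TopologicalSpace.SeparableSpace H₁] [Nontrivial H₁]
    [NormedAddCommGroup H₂] [InnerProductSpace ℂ H₂] [CompleteSpace H₂]
    [TopologicalSpace.SeparableSpace H₂] [Nontrivial H₂]
    (φ : compactOperator (RingHom.id ℂ) H₁ H₂ →ₗ[ℂ] compactOperator (RingHom.id ℂ) H₁ H₂)
    (hφ : ∀ (a b : compactOperator (RingHom.id ℂ) H₁ H₂)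
        (x : H₂ →L[ℂ] H₂) (y : H₁ →L[ℂ] H₁),
        IsCompactOperator x → IsCompactOperator y →
        (b : H₁ →L[ℂ] H₂) = x.comp ((a : H₁ →L[ℂ] H₂).comp y) →
        (φ b : H₁ →L[ℂ] H₂) = x.comp ((φ a : H₁ →L[ℂ] H₂).comp y)) :
    ∃ c : ℂ, ∀ a, φ a = c • a := by
  obtain ⟨e, he⟩ := exists_norm_eq H₁ (zero_le_one (α := ℝ))
  obtain ⟨f, hf⟩ := exists_norm_eq H₂ (zero_le_one (α := ℝ))
  let p : compactOperator (RingHom.id ℂ) H₁ H₂ :=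
    ⟨InnerProductSpace.rankOne ℂ f e, isCompactOperator_rankOne_aux f e⟩
  refine ⟨inner ℂ f ((φ p : H₁ →L[ℂ] H₂) e), fun a => ?_⟩
  apply Subtype.ext
  ext v
  refine ext_inner_left ℂ fun w => ?_
  have h := hφ a ((inner ℂ w ((a : H₁ →L[ℂ] H₂) v)) • p)
    (InnerProductSpace.rankOne ℂ f w) (InnerProductSpace.rankOne ℂ v e)
    (isCompactOperator_rankOne_aux f w) (isCompactOperator_rankOne_aux v e) (by
      ext u
      simp [p, smul_smul, inner_smul_right, mul_comm])
  have h2 := congrArg (fun T : H₁ →L[ℂ] H₂ => inner ℂ f (T e)) h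
  simp [inner_smul_right, inner_self_eq_norm_sq_to_K, he, hf] at h2
  simp [inner_smul_right, ← h2, mul_comm]
end

section
/- Let H₁ and H₂ be nonzero separable complex Hilbert spaces. The complex vector space of bimodule endomorphisms of K(H₁,H₂) is one-dimensional, spanned by the identity map; equivalently, the linear map ℂ → {bimodule endomorphisms of K(H₁,H₂)} sending c to the map a ↦ c • a is a bijection. -/
/-- A `ℂ`-linear endomorphism `φ` of the space of compact operators `K(H₁,H₂)` is a
*bimodule endomorphism* if `φ (x ∘ a ∘ y) = x ∘ φ a ∘ y` for every `a ∈ K(H₁,H₂)` and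
all compact operators `x ∈ K(H₂)`, `y ∈ K(H₁)`. -/
def IsBimoduleEnd (H₁ H₂ : Type*)
    [NormedAddCommGroup H₁] [InnerProductSpace ℂ H₁]
    [NormedAddCommGroup H₂] [InnerProductSpace ℂ H₂]
    (φ : compactOperator (RingHom.id ℂ) H₁ H₂ →ₗ[ℂ] compactOperator (RingHom.id ℂ) H₁ H₂) :
    Prop :=
  ∀ (a b : compactOperator (RingHom.id ℂ) H₁ H₂)
    (x : H₂ →L[ℂ] H₂) (y : H₁ →L[ℂ] H₁),
    IsCompactOperator x → IsCompactOperator y →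
    (b : H₁ →L[ℂ] H₂) = x.comp ((a : H₁ →L[ℂ] H₂).comp y) →
    (φ b : H₁ →L[ℂ] H₂) = x.comp ((φ a : H₁ →L[ℂ] H₂).comp y)

/-- The rank one operator `z ↦ ⟪e, z⟫ f`. -/
noncomputable def rkOne {E F : Type*} [NormedAddCommGroup E] [InnerProductSpace ℂ E]
    [NormedAddCommGroup F] [InnerProductSpace ℂ F] (f : F) (e : E) : E →L[ℂ] F :=
  (innerSL ℂ e).smulRight f

theorem rkOne_apply {E F : Type*} [NormedAddCommGroup E] [InnerProductSpace ℂ E]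
    [NormedAddCommGroup F] [InnerProductSpace ℂ F] (f : F) (e z : E) :
    rkOne f e z = (inner ℂ e z) • f := by
  simp [rkOne]

theorem rkOne_compact {E F : Type*} [NormedAddCommGroup E] [InnerProductSpace ℂ E]
    [NormedAddCommGroup F] [InnerProductSpace ℂ F] (f : F) (e : E) :
    IsCompactOperator (rkOne f e) := by
  have h : IsCompactOperator (innerSL ℂ e) :=
    isCompactOperator_of_locallyCompactSpace_dom _
  exact h.clm_comp (ContinuousLinearMap.toSpanSingleton ℂ f)

/-- Let `H₁` and `H₂` be nonzero separable complex Hilbert spaces.  The complex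
vector space of bimodule endomorphisms of `K(H₁,H₂)` is one-dimensional, spanned by the
identity: the map `ℂ → {bimodule endomorphisms}` sending `c` to `a ↦ c • a` is a bijection,
i.e. every `c • id` is a bimodule endomorphism, and every bimodule endomorphism is equal to
`c • id` for a *unique* scalar `c : ℂ`. -/
theorem bimoduleEnd_one_dimensional
    (H₁ H₂ : Type*)
    [NormedAddCommGroup H₁] [InnerProductSpace ℂ H₁] [CompleteSpace H₁]
    [TopologicalSpace.SeparableSpace H₁] [Nontrivial H₁]
    [NormedAddCommGroup H₂] [InnerProductSpace ℂ H₂] [CompleteSpace H₂]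
    [TopologicalSpace.SeparableSpace H₂] [Nontrivial H₂] :
    (∀ c : ℂ, IsBimoduleEnd H₁ H₂
        (c • (LinearMap.id : compactOperator (RingHom.id ℂ) H₁ H₂ →ₗ[ℂ]
          compactOperator (RingHom.id ℂ) H₁ H₂))) ∧
    (∀ φ : compactOperator (RingHom.id ℂ) H₁ H₂ →ₗ[ℂ] compactOperator (RingHom.id ℂ) H₁ H₂,
        IsBimoduleEnd H₁ H₂ φ → ∃! c : ℂ, φ = c • LinearMap.id) := by
  constructor
  · intro c a b x y _ _ hb
    ext z
    have := congrArg (fun g : H₁ →L[ℂ] H₂ => g z) hb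
    simp at this
    simp [this]
  · intro φ hφ
    obtain ⟨e, he⟩ := exists_norm_eq H₁ zero_le_one
    obtain ⟨f, hf⟩ := exists_norm_eq H₂ zero_le_one
    have hee : inner ℂ e e = (1 : ℂ) := by simp [inner_self_eq_norm_sq_to_K, he]
    have hff : inner ℂ f f = (1 : ℂ) := by simp [inner_self_eq_norm_sq_to_K, hf]
    let T : compactOperator (RingHom.id ℂ) H₁ H₂ := ⟨rkOne f e, rkOne_compact f e⟩
    have hTe : (T : H₁ →L[ℂ] H₂) e = f := by
      change rkOne f e e = f
      rw [rkOne_apply, hee, one_smul]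
    have key : ∀ (a : compactOperator (RingHom.id ℂ) H₁ H₂) (w : H₂) (v : H₁),
        inner ℂ w ((φ a : H₁ →L[ℂ] H₂) v) =
          inner ℂ w ((a : H₁ →L[ℂ] H₂) v) * inner ℂ f ((φ T : H₁ →L[ℂ] H₂) e) := by
      intro a w v
      have h := hφ a ((inner ℂ w ((a : H₁ →L[ℂ] H₂) v) : ℂ) • T) (rkOne f w) (rkOne v e)
        (rkOne_compact _ _) (rkOne_compact _ _) (by
          ext z
          change (inner ℂ w ((a : H₁ →L[ℂ] H₂) v) : ℂ) • rkOne f e z = rkOne f w ((a : H₁ →L[ℂ] H₂) (rkOne v e z))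
          simp only [rkOne_apply, map_smul, smul_smul]
          rw [mul_comm])
      have h2 := congrArg (fun g : H₁ →L[ℂ] H₂ => (inner ℂ f (g e) : ℂ)) h
      rw [map_smul] at h2
      simp [rkOne_apply, he, hf] at h2
      exact h2.symm
    refine ⟨inner ℂ f ((φ T : H₁ →L[ℂ] H₂) e), ?_, ?_⟩
    · ext a v
      refine ext_inner_left ℂ fun w => ?_
      rw [key a w v]
      simp [inner_smul_right, mul_comm]
    · intro c hc
      rw [hc]
      simp [hTe, hf]
end

section
/- Let (C*, d) be a cochain complex of abelian groups concentrated in nonnegative degrees, and let Z* ⊆ C* and Ω* ⊆ C* be subcomplexes. Suppose the inclusion Ω* ↪ C* induces a surjection H²(Ω*) → H²(C*) and an isomorphism H³(Ω*) → H³(C*). Then for each height s ∈ {1,2}, the projection (c,h,ω) ↦ c from the differential cochain complex DC_s* to Z* induces an isomorphism of abelian groups H³(DC_s*) ≅ H³(Z*). -/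
/-- Let `(C*, d)` be a cochain complex of abelian groups concentrated in
nonnegative degrees, and let `Z* ⊆ C*` and `Ω* ⊆ C*` be subcomplexes.  Assume the inclusion
`Ω* ↪ C*` induces a surjection `H²(Ω*) → H²(C*)` and an isomorphism `H³(Ω*) → H³(C*)`
(both stated elementarily below).  For a height `s ∈ {1, 2}`, the differential cochain
complex is `DC_s^k = {(c,h,ω) ∈ Z^k × C^{k-1} × Ω^k : ω = 0 if k < s}` with differential
`d(c,h,ω) = (dc, ω - c - dh, dω)`.  The conclusion asserts, elementarily, that the projection
`(c,h,ω) ↦ c` induces an isomorphism `H³(DC_s*) ≅ H³(Z*)`: the induced map (which is an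
additive group homomorphism) is surjective and injective on degree-3 cohomology, i.e.
every 3-cocycle of `Z*` is cohomologous in `Z*` to the projection of a 3-cocycle of `DC_s*`,
and every 3-cocycle of `DC_s*` whose projection is a coboundary in `Z*` is itself a
coboundary in `DC_s*`. -/
theorem dc_proj_iso_H3
    (C : ℕ → Type*) [∀ n, AddCommGroup (C n)]
    (d : ∀ n, C n →+ C (n + 1))
    (hdd : ∀ (n : ℕ) (x : C n), d (n + 1) (d n x) = 0)
    (Z Ω : ∀ n, AddSubgroup (C n))
    (hZ : ∀ (n : ℕ) (x : C n), x ∈ Z n → d n x ∈ Z (n + 1))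
    (hΩ : ∀ (n : ℕ) (x : C n), x ∈ Ω n → d n x ∈ Ω (n + 1))
    -- `H²(Ω*) → H²(C*)` is surjective:
    (hΩsurj2 : ∀ x : C 2, d 2 x = 0 →
      ∃ ω ∈ Ω 2, d 2 ω = 0 ∧ ∃ y : C 1, x - ω = d 1 y)
    -- `H³(Ω*) → H³(C*)` is surjective:
    (hΩsurj3 : ∀ x : C 3, d 3 x = 0 →
      ∃ ω ∈ Ω 3, d 3 ω = 0 ∧ ∃ y : C 2, x - ω = d 2 y)
    -- `H³(Ω*) → H³(C*)` is injective:
    (hΩinj3 : ∀ ω : C 3, ω ∈ Ω 3 → d 3 ω = 0 →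
      (∃ y : C 2, ω = d 2 y) → ∃ τ ∈ Ω 2, ω = d 2 τ)
    (s : ℕ) (hs : s = 1 ∨ s = 2) :
    -- surjectivity of `H³(DC_s*) → H³(Z*)`:
    (∀ c : C 3, c ∈ Z 3 → d 3 c = 0 →
      ∃ (c' h ω : _), c' ∈ Z 3 ∧ ω ∈ Ω 3 ∧ (3 < s → ω = 0) ∧
        d 3 c' = 0 ∧ ω - c' - d 2 h = 0 ∧ d 3 ω = 0 ∧
        ∃ b ∈ Z 2, c - c' = d 2 b) ∧
    -- injectivity of `H³(DC_s*) → H³(Z*)`: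
    (∀ (c : C 3) (h : C 2) (ω : C 3), c ∈ Z 3 → ω ∈ Ω 3 → (3 < s → ω = 0) →
      d 3 c = 0 → ω - c - d 2 h = 0 → d 3 ω = 0 →
      (∃ b ∈ Z 2, c = d 2 b) →
      ∃ (b : C 2) (g : C 1) (τ : C 2), b ∈ Z 2 ∧ τ ∈ Ω 2 ∧ (2 < s → τ = 0) ∧
        c = d 2 b ∧ h = τ - b - d 1 g ∧ ω = d 2 τ) := by
  constructor
  · intro c hc hdc
    obtain ⟨ω, hω, hdω, y, hy⟩ := hΩsurj3 c hdc
    refine ⟨c, -y, ω, hc, hω, fun h => by omega, hdc, ?_, hdω, 0, (Z 2).zero_mem, ?_⟩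
    · rw [map_neg, ← hy]; abel
    · rw [map_zero, sub_self]
  · rintro c h ω hc hω - hdc hrel hdω ⟨b, hb, hcb⟩
    have hωeq : ω = d 2 (b + h) := by
      rw [map_add, ← hcb]
      have h1 : ω - (c + d 2 h) = 0 := by rw [← hrel]; abel
      exact sub_eq_zero.mp h1
    obtain ⟨τ, hτ, hωτ⟩ := hΩinj3 ω hω hdω ⟨_, hωeq⟩
    have hx : d 2 (b + h - τ) = 0 := by
      rw [map_sub, ← hωeq, ← hωτ, sub_self]
    obtain ⟨σ, hσ, hdσ, y, hy⟩ := hΩsurj2 _ hx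
    refine ⟨b, -y, τ + σ, hb, (Ω 2).add_mem hτ hσ, fun h => by omega, hcb, ?_, ?_⟩
    · rw [map_neg, ← hy]; abel
    · rw [map_add, hdσ, add_zero, hωτ]
end
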